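/- There exists a constant C ≥ 1 such that for every integer n ≥ 5 the graph C_n² admits a contact representation by convex quadrilaterals in ℝ³ with side-length ratio at most C: there is an injective assignment e ↦ p_e of points of ℝ³ to the edges of C_n² such that, for each vertex v (which has degree 4), the four points {p_e : e incident to v} are coplanar, each is an extreme point of their convex hull Q_v, and can be labeled a_v, b_v, c_v, d_v so that the segments [a_v, c_v] and [b_v, d_v] intersect (cyclic order along the boundary of Q_v); for distinct vertices u, v one has Q_u ∩ Q_v = {p_{uv}} if uv is an edge of C_n² and Q_u ∩ Q_v = ∅ otherwise; and the ratio between the maximum and the minimum of the side lengths dist(a_v,b_v), dist(b_v,c_v), dist(c_v,d_v), dist(d_v,a_v), taken over all vertices v, is at most C. -/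

import Mathlib

/-- Adjacency in the square `Cₙ²` of the `n`-cycle on vertex set `ZMod n`:
distinct vertices `u, v` are adjacent iff `u - v ∈ {1, -1, 2, -2}`. -/
def cycleSquareAdj (n : ℕ) (u v : ZMod n) : Prop :=
  u ≠ v ∧ (u - v = 1 ∨ u - v = -1 ∨ u - v = 2 ∨ u - v = -2)

open Real in
/-- The angle `2π / n`. -/
noncomputable def stepAngle (n : ℕ) : ℝ := 2 * π / n

/-- Distance from the centre to the edges of the star polygon `{n/2}` with half edge length `1`. -/
noncomputable def starInradius (n : ℕ) : ℝ := Real.cos (stepAngle n) / Real.sin (stepAngle n)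

/-- Distance on an edge of the star polygon `{n/2}` from the midpoint to the crossing with the
next edge, the half edge length being `1`. -/
noncomputable def starOffset (n : ℕ) : ℝ := Real.cos (stepAngle n) / (1 + Real.cos (stepAngle n))

/-- The point at height `z` above the point with coordinate `x` on the `i`-th edge of the star
polygon `{n/2}`. -/
noncomputable def starPoint {n : ℕ} (i : ZMod n) (x z : ℝ) : EuclideanSpace ℝ (Fin 3) :=
  !₂[starInradius n * Real.cos (stepAngle n * i.val) - x * Real.sin (stepAngle n * i.val),
    starInradius n * Real.sin (stepAngle n * i.val) + x * Real.cos (stepAngle n * i.val), z]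

/-- The linear functional taking the value `A * x + B * z` at `starPoint i x z`. -/
noncomputable def edgeFunctional {n : ℕ} (i : ZMod n) (A B : ℝ) :
    EuclideanSpace ℝ (Fin 3) →ₗ[ℝ] ℝ where
  toFun p := A * (-Real.sin (stepAngle n * i.val) * p 0 + Real.cos (stepAngle n * i.val) * p 1)
    + B * p 2
  map_add' p q := by simp only [PiLp.add_apply]; ring
  map_smul' c p := by simp only [PiLp.smul_apply, smul_eq_mul, RingHom.id_apply]; ring

/-- The corners of the vertical quadrilateral over the `i`-th edge of the star polygon, listed
along the edge. -/
noncomputable def edgeCorner {n : ℕ} (i : ZMod n) (z : Fin 4 → ℝ) :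
    Fin 4 → EuclideanSpace ℝ (Fin 3) :=
  ![starPoint i (-1) (z 0), starPoint i (-starOffset n) (z 1), starPoint i (starOffset n) (z 2),
    starPoint i 1 (z 3)]

lemma edgeFunctional_starPoint {n : ℕ} (i : ZMod n) (A B x z : ℝ) :
    edgeFunctional i A B (starPoint i x z) = A * x + B * z := by
  simp only [edgeFunctional, starPoint, LinearMap.coe_mk, AddHom.coe_mk]
  simp only [Matrix.cons_val]
  linear_combination A * x * Real.sin_sq_add_cos_sq (stepAngle n * i.val)

lemma stepAngle_pos {n : ℕ} (hn : 5 ≤ n) : 0 < stepAngle n := by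
  unfold stepAngle
  have : (0 : ℝ) < n := by exact_mod_cast (by omega : 0 < n)
  have := Real.pi_pos
  positivity

lemma stepAngle_mul {n : ℕ} (hn : 5 ≤ n) : stepAngle n * n = 2 * Real.pi := by
  unfold stepAngle
  have : (n : ℝ) ≠ 0 := by exact_mod_cast (by omega : n ≠ 0)
  field_simp

lemma stepAngle_le {n : ℕ} (hn : 5 ≤ n) : stepAngle n ≤ 2 * (Real.pi / 5) := by
  have h5 : (5 : ℝ) ≤ n := by exact_mod_cast hn
  have h1 := stepAngle_mul hn
  have h2 := stepAngle_pos hn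
  nlinarith

lemma one_div_four_le_cos_stepAngle {n : ℕ} (hn : 5 ≤ n) : 1 / 4 ≤ Real.cos (stepAngle n) := by
  have h1 : Real.cos (2 * (Real.pi / 5)) ≤ Real.cos (stepAngle n) :=
    Real.cos_le_cos_of_nonneg_of_le_pi (stepAngle_pos hn).le (by linarith [Real.pi_pos])
      (stepAngle_le hn)
  rw [Real.cos_two_mul, Real.cos_pi_div_five] at h1
  have h2 : (2.2 : ℝ) ≤ √5 := Real.le_sqrt_of_sq_le (by norm_num)
  nlinarith

lemma sin_stepAngle_pos {n : ℕ} (hn : 5 ≤ n) : 0 < Real.sin (stepAngle n) :=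
  Real.sin_pos_of_pos_of_lt_pi (stepAngle_pos hn)
    (by linarith [stepAngle_le hn, Real.pi_pos])

lemma starOffset_bounds {n : ℕ} (hn : 5 ≤ n) : 1 / 5 ≤ starOffset n ∧ starOffset n ≤ 1 / 2 := by
  have h1 := one_div_four_le_cos_stepAngle hn
  have h2 := Real.cos_le_one (stepAngle n)
  unfold starOffset
  constructor
  · rw [le_div_iff₀ (by linarith)]; linarith
  · rw [div_le_iff₀ (by linarith)]; linarith

lemma exists_intCast_stepAngle {n : ℕ} (hn : 5 ≤ n) (a : ℤ) : ∃ m : ℤ,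
    stepAngle n * ((a : ZMod n).val : ℝ) = stepAngle n * a + m * (2 * Real.pi) := by
  have : NeZero n := ⟨by omega⟩
  refine ⟨-(a / n), ?_⟩
  have h1 : (((a : ZMod n).val : ℤ)) = a % n := ZMod.val_intCast a
  have h2 := Int.mul_ediv_add_emod a n
  have h3 : ((a : ZMod n).val : ℝ) = a - n * ((a / n : ℤ) : ℝ) := by
    have : (((a : ZMod n).val : ℤ)) = a - n * (a / n) := by omega
    exact_mod_cast this
  rw [h3, ← stepAngle_mul hn]
  push_cast
  ring

lemma starPoint_intCast {n : ℕ} (hn : 5 ≤ n) (a : ℤ) (x z : ℝ) :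
    starPoint (a : ZMod n) x z =
      !₂[starInradius n * Real.cos (stepAngle n * a) - x * Real.sin (stepAngle n * a),
        starInradius n * Real.sin (stepAngle n * a) + x * Real.cos (stepAngle n * a), z] := by
  obtain ⟨m, hm⟩ := exists_intCast_stepAngle hn a
  rw [starPoint, hm, Real.cos_add_int_mul_two_pi, Real.sin_add_int_mul_two_pi]

lemma euclidean_three_ext {a b c a' b' c' : ℝ} (h0 : a = a') (h1 : b = b') (h2 : c = c') :
    (!₂[a, b, c] : EuclideanSpace ℝ (Fin 3)) = !₂[a', b', c'] := by
  rw [h0, h1, h2]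

lemma starPoint_add_one {n : ℕ} (hn : 5 ≤ n) (i : ZMod n) (z : ℝ) :
    starPoint (i + 1) (-starOffset n) z = starPoint i (starOffset n) z := by
  obtain ⟨a, rfl⟩ := ZMod.intCast_surjective i
  have hc := one_div_four_le_cos_stepAngle hn
  have hs := sin_stepAngle_pos hn
  have hsc := Real.sin_sq_add_cos_sq (stepAngle n)
  have h : ((a : ZMod n) + 1) = ((a + 1 : ℤ) : ZMod n) := by push_cast; rfl
  rw [h, starPoint_intCast hn, starPoint_intCast hn]
  have h' : stepAngle n * ((a + 1 : ℤ) : ℝ) = stepAngle n * a + stepAngle n := by push_cast; ring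
  rw [h', Real.cos_add, Real.sin_add, starInradius, starOffset]
  set c := Real.cos (stepAngle n)
  set s := Real.sin (stepAngle n)
  have hc1 : 1 + c ≠ 0 := by linarith
  refine euclidean_three_ext ?_ ?_ rfl
  · field_simp
    linear_combination Real.cos (stepAngle n * a) * hsc
  · field_simp
    linear_combination Real.sin (stepAngle n * a) * hsc

lemma starPoint_add_two {n : ℕ} (hn : 5 ≤ n) (i : ZMod n) (z : ℝ) :
    starPoint (i + 2) (-1) z = starPoint i 1 z := by
  obtain ⟨a, rfl⟩ := ZMod.intCast_surjective i
  have hs := sin_stepAngle_pos hn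
  have hsc := Real.sin_sq_add_cos_sq (stepAngle n)
  have h : ((a : ZMod n) + 2) = ((a + 2 : ℤ) : ZMod n) := by push_cast; rfl
  rw [h, starPoint_intCast hn, starPoint_intCast hn]
  have h' : stepAngle n * ((a + 2 : ℤ) : ℝ) = stepAngle n * a + 2 * stepAngle n := by
    push_cast; ring
  rw [h', Real.cos_add, Real.sin_add, Real.cos_two_mul, Real.sin_two_mul, starInradius]
  set c := Real.cos (stepAngle n)
  set s := Real.sin (stepAngle n)
  refine euclidean_three_ext ?_ ?_ rfl
  · field_simp
    linear_combination 2 * c * Real.cos (stepAngle n * a) * hsc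
  · field_simp
    linear_combination 2 * c * Real.sin (stepAngle n * a) * hsc

lemma rotation_eqs {r x y c s C S : ℝ} (h : s ^ 2 + c ^ 2 = 1) (H : S ^ 2 + C ^ 2 = 1)
    (e0 : r * c - x * s = r * (c * C - s * S) - y * (s * C + c * S))
    (e1 : r * s + x * c = r * (s * C + c * S) + y * (c * C - s * S)) :
    r = r * C - y * S ∧ r = r * C + x * S := by
  have g0 : r = r * C - y * S := by
    linear_combination c * e0 + s * e1 + (r * C - y * S - r) * h
  have g1 : x = r * S + y * C := by
    linear_combination -s * e0 + c * e1 + (r * S + y * C - x) * h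
  exact ⟨g0, by linear_combination -C * g0 - S * g1 - r * H⟩

/-- Points over two different edges of the star polygon agree only over the crossings of
neighbouring edges and over the vertices. -/
lemma starPoint_eq_starPoint {n : ℕ} (hn : 5 ≤ n) {i j : ZMod n} (hij : i ≠ j) {x y z w : ℝ}
    (hx : |x| ≤ 1) (h : starPoint i x z = starPoint j y w) :
    y = -x ∧ w = z ∧ ((j = i + 1 ∧ x = starOffset n) ∨ (j = i + 2 ∧ x = 1) ∨
      (i = j + 1 ∧ x = -starOffset n) ∨ (i = j + 2 ∧ x = -1)) := by
  have : NeZero n := ⟨by omega⟩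
  obtain ⟨a, rfl⟩ := ZMod.intCast_surjective i
  obtain ⟨k, hk, hkn⟩ : ∃ k : ℤ, j = ((a + k : ℤ) : ZMod n) ∧ 2 * |k| ≤ n := by
    refine ⟨(j - (a : ZMod n)).valMinAbs, ?_, ?_⟩
    · rw [Int.cast_add, ZMod.coe_valMinAbs]; ring
    · have := ZMod.natAbs_valMinAbs_le (j - (a : ZMod n))
      rw [Int.abs_eq_natAbs]; omega
  subst hk
  have hk0 : k ≠ 0 := by rintro rfl; simp at hij
  rw [starPoint_intCast hn, starPoint_intCast hn] at h
  have e0 := congrArg (fun p : EuclideanSpace ℝ (Fin 3) => p 0) h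
  have e1 := congrArg (fun p : EuclideanSpace ℝ (Fin 3) => p 1) h
  have e2 := congrArg (fun p : EuclideanSpace ℝ (Fin 3) => p 2) h
  simp at e0 e1 e2
  set φ := stepAngle n * (k / 2 : ℝ) with hφ
  have h' : stepAngle n * ((a : ℝ) + k) = stepAngle n * a + 2 * φ := by
    rw [hφ]; ring
  have hc := one_div_four_le_cos_stepAngle hn
  have hs := sin_stepAngle_pos hn
  have hθ := stepAngle_pos hn
  have hθn := stepAngle_mul hn
  have hθle := stepAngle_le hn
  have hsc := Real.sin_sq_add_cos_sq (stepAngle n)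
  have hpi := Real.pi_pos
  have hr : 0 < starInradius n := div_pos (by linarith) hs
  have hrs : starInradius n * Real.sin (stepAngle n) = Real.cos (stepAngle n) := by
    unfold starInradius; field_simp
  have hsk : Real.sin φ ^ 2 + Real.cos φ ^ 2 = 1 := Real.sin_sq_add_cos_sq φ
  have hsa := Real.sin_sq_add_cos_sq (stepAngle n * a)
  rw [h', Real.cos_add, Real.sin_add] at e0 e1
  obtain ⟨g0, g1⟩ := rotation_eqs hsa (Real.sin_sq_add_cos_sq (2 * φ)) e0 e1
  rw [Real.cos_two_mul, Real.sin_two_mul] at g0 g1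
  have hkR : |(k : ℝ)| * 2 ≤ n := by
    have : |k| * 2 ≤ n := by omega
    exact_mod_cast this
  have habs : |φ| = stepAngle n * (|(k : ℝ)| / 2) := by
    rw [hφ, abs_mul, abs_of_pos hθ, abs_div]; norm_num
  have hφle : |φ| ≤ Real.pi / 2 := by rw [habs]; nlinarith
  have hφ0 : φ ≠ 0 := by
    rw [hφ]; have : (k : ℝ) ≠ 0 := by exact_mod_cast hk0
    positivity
  have hs0 : Real.sin φ ≠ 0 := by
    intro h0
    exact hφ0 ((Real.sin_eq_zero_iff_of_lt_of_lt (by linarith [(abs_le.1 hφle).1])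
      (by linarith [(abs_le.1 hφle).2])).1 h0)
  have hxc : starInradius n * Real.sin φ = x * Real.cos φ := by
    apply mul_left_cancel₀ hs0
    linear_combination g1 / 2 + starInradius n * hsk
  have hyc : starInradius n * Real.sin φ = -y * Real.cos φ := by
    apply mul_left_cancel₀ hs0
    linear_combination g0 / 2 + starInradius n * hsk
  have hc0 : Real.cos φ ≠ 0 := by
    intro h0; rw [h0, mul_zero] at hxc
    rcases mul_eq_zero.1 hxc with h | h
    · exact hr.ne' h
    · exact hs0 h
  have hyx : y = -x := by
    have := mul_right_cancel₀ hc0 (hxc.symm.trans hyc)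
    linarith
  refine ⟨hyx, e2.symm, ?_⟩
  have hk3 : |k| < 3 := by
    by_contra! hge
    have hgeR : (3 : ℝ) ≤ |(k : ℝ)| := by exact_mod_cast hge
    have h1 : Real.sin (stepAngle n) < Real.sin |φ| := by
      refine Real.strictMonoOn_sin ⟨by linarith, by linarith⟩
        ⟨by linarith [abs_nonneg φ], hφle⟩ ?_
      rw [habs]; nlinarith
    have h2 : Real.sin |φ| ^ 2 = Real.sin φ ^ 2 := by
      rcases abs_choice φ with h | h <;> rw [h]
      rw [Real.sin_neg]; ring
    have h3 : x ^ 2 ≤ 1 := (sq_le_one_iff_abs_le_one x).2 hx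
    have h4 : starInradius n ^ 2 * Real.sin φ ^ 2 ≤ Real.cos φ ^ 2 := by
      have : starInradius n ^ 2 * Real.sin φ ^ 2 = x ^ 2 * Real.cos φ ^ 2 := by
        rw [← mul_pow, hxc, mul_pow]
      rw [this]; exact mul_le_of_le_one_left (sq_nonneg _) h3
    have h5 : Real.sin φ ^ 2 ≤ Real.sin (stepAngle n) ^ 2 := by
      have : (Real.cos (stepAngle n)) ^ 2 * Real.sin φ ^ 2
          ≤ Real.sin (stepAngle n) ^ 2 * Real.cos φ ^ 2 := by
        rw [← hrs, mul_pow, mul_right_comm, mul_comm]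
        exact mul_le_mul_of_nonneg_left h4 (sq_nonneg _)
      rw [← eq_sub_iff_add_eq'] at hsk hsc
      rw [hsk, hsc] at this
      linarith
    rw [h2.symm] at h5
    exact absurd h5 (not_le.2 (pow_lt_pow_left₀ h1 hs.le two_ne_zero))
  have htan : starInradius n * Real.sin (stepAngle n / 2)
      = starOffset n * Real.cos (stepAngle n / 2) := by
    have hd := Real.cos_two_mul (stepAngle n / 2)
    have hd' := Real.sin_two_mul (stepAngle n / 2)
    rw [mul_div_cancel₀ _ two_ne_zero] at hd hd'
    unfold starInradius starOffset
    have : 1 + Real.cos (stepAngle n) ≠ 0 := by linarith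
    field_simp
    rw [hd', hd]; ring
  have hk4 : k = 1 ∨ k = 2 ∨ k = -1 ∨ k = -2 := by
    rw [abs_lt] at hk3; omega
  rcases hk4 with rfl | rfl | rfl | rfl
  · left
    refine ⟨by push_cast; ring, ?_⟩
    have : φ = stepAngle n / 2 := by rw [hφ]; push_cast; ring
    rw [this] at hxc hc0
    exact mul_right_cancel₀ hc0 (hxc.symm.trans htan)
  · right; left
    refine ⟨by push_cast; ring, ?_⟩
    have : φ = stepAngle n := by rw [hφ]; push_cast; ring
    rw [this] at hxc hc0
    exact mul_right_cancel₀ hc0 (by linarith)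
  · right; right; left
    refine ⟨by push_cast; ring, ?_⟩
    have : φ = -(stepAngle n / 2) := by rw [hφ]; push_cast; ring
    rw [this, Real.cos_neg, Real.sin_neg] at hxc
    rw [this, Real.cos_neg] at hc0
    exact mul_right_cancel₀ hc0 (by linarith)
  · right; right; right
    refine ⟨by push_cast; ring, ?_⟩
    have : φ = -stepAngle n := by rw [hφ]; push_cast; ring
    rw [this, Real.cos_neg, Real.sin_neg] at hxc
    rw [this, Real.cos_neg] at hc0
    exact mul_right_cancel₀ hc0 (by linarith)

lemma eq_or_lt_of_mem_convexHull {E ι : Type*} [AddCommGroup E] [Module ℝ E] {q : ι → E} {k : ι}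
    (f : E →ₗ[ℝ] ℝ) (h : ∀ j, j ≠ k → f (q j) < f (q k)) {p : E}
    (hp : p ∈ convexHull ℝ (Set.range q)) : p = q k ∨ f p < f (q k) := by
  suffices H : convexHull ℝ (Set.range q) ⊆ {p | p = q k ∨ f p < f (q k)} from H hp
  refine convexHull_min ?_ ?_
  · rintro _ ⟨j, rfl⟩
    by_cases hj : j = k
    · left; rw [hj]
    · right; exact h j hj
  · rw [convex_iff_forall_pos]
    rintro x hx y hy a b ha hb hab
    obtain rfl : a = 1 - b := by linarith
    simp only [Set.mem_ofPred_eq, map_add, map_smul, smul_eq_mul]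
    rcases hx with rfl | hx <;> rcases hy with rfl | hy
    · left; rw [← add_smul, hab, one_smul]
    · right; nlinarith
    · right; nlinarith
    · right; nlinarith

lemma notMem_convexHull_diff {E ι : Type*} [AddCommGroup E] [Module ℝ E] {q : ι → E} {k : ι}
    (f : E →ₗ[ℝ] ℝ) (h : ∀ j, j ≠ k → f (q j) < f (q k)) :
    q k ∉ convexHull ℝ (convexHull ℝ (Set.range q) \ {q k}) := by
  intro hk
  have H : convexHull ℝ (convexHull ℝ (Set.range q) \ {q k}) ⊆ {p | f p < f (q k)} :=
    convexHull_min (fun p hp => (eq_or_lt_of_mem_convexHull f h hp.1).resolve_left hp.2)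
      (convex_halfSpace_lt f.isLinear _)
  exact lt_irrefl (f (q k)) (H hk)

/-- Height of the second corner above the line through the first and the last corner of the
quadrilateral with corner heights `z`. -/
noncomputable def leftDeviation (t : ℝ) (z : Fin 4 → ℝ) : ℝ :=
  z 1 - ((z 0 + z 3) / 2 - t * ((z 3 - z 0) / 2))

/-- Height of the third corner above the line through the first and the last corner of the
quadrilateral with corner heights `z`. -/
noncomputable def rightDeviation (t : ℝ) (z : Fin 4 → ℝ) : ℝ :=
  z 2 - ((z 0 + z 3) / 2 + t * ((z 3 - z 0) / 2))

/-- Condition on the corner heights ensuring strictly convex position of the corners. -/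
structure ConvexHeights (t : ℝ) (z : Fin 4 → ℝ) : Prop where
  left_ne : leftDeviation t z ≠ 0
  right_ne : rightDeviation t z ≠ 0
  left_le : leftDeviation t z * rightDeviation t z ≤ 4 / 3 * rightDeviation t z ^ 2
  right_le : leftDeviation t z * rightDeviation t z ≤ 4 / 3 * leftDeviation t z ^ 2

section Quadrilateral

variable {n : ℕ} (hn : 5 ≤ n) (i : ZMod n) {z : Fin 4 → ℝ}

include hn

lemma edgeFunctional_lt_zero {j : Fin 4} (hj : j ≠ 0) :
    edgeFunctional i (-1) 0 (edgeCorner i z j) < edgeFunctional i (-1) 0 (edgeCorner i z 0) := by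
  obtain ⟨h1, h2⟩ := starOffset_bounds hn
  fin_cases j <;> simp [edgeCorner, edgeFunctional_starPoint] at hj ⊢ <;> linarith

lemma edgeFunctional_lt_three {j : Fin 4} (hj : j ≠ 3) :
    edgeFunctional i 1 0 (edgeCorner i z j) < edgeFunctional i 1 0 (edgeCorner i z 3) := by
  obtain ⟨h1, h2⟩ := starOffset_bounds hn
  fin_cases j <;> simp [edgeCorner, edgeFunctional_starPoint] at hj ⊢ <;> linarith

lemma edgeFunctional_lt_two (hz : ConvexHeights (starOffset n) z) {j : Fin 4} (hj : j ≠ 2) :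
    edgeFunctional i (rightDeviation (starOffset n) z *
        (rightDeviation (starOffset n) z - (z 3 - z 0) / 2))
        (rightDeviation (starOffset n) z) (edgeCorner i z j) <
      edgeFunctional i (rightDeviation (starOffset n) z *
        (rightDeviation (starOffset n) z - (z 3 - z 0) / 2))
        (rightDeviation (starOffset n) z) (edgeCorner i z 2) := by
  obtain ⟨h1, h2⟩ := starOffset_bounds hn
  obtain ⟨hl, hr, h3, h4⟩ := hz
  have e1 : z 1 = leftDeviation (starOffset n) z +
    ((z 0 + z 3) / 2 - starOffset n * ((z 3 - z 0) / 2)) := by unfold leftDeviation; ring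
  have e2 : z 2 = rightDeviation (starOffset n) z +
    ((z 0 + z 3) / 2 + starOffset n * ((z 3 - z 0) / 2)) := by unfold rightDeviation; ring
  set d := rightDeviation (starOffset n) z
  set e := leftDeviation (starOffset n) z
  have hd : 0 < d ^ 2 := by positivity
  fin_cases j <;> simp [edgeCorner, edgeFunctional_starPoint] at hj ⊢ <;>
    simp only [e1, e2] <;> nlinarith

lemma edgeFunctional_lt_one (hz : ConvexHeights (starOffset n) z) {j : Fin 4} (hj : j ≠ 1) :
    edgeFunctional i (-leftDeviation (starOffset n) z *
        (leftDeviation (starOffset n) z + (z 3 - z 0) / 2))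
        (leftDeviation (starOffset n) z) (edgeCorner i z j) <
      edgeFunctional i (-leftDeviation (starOffset n) z *
        (leftDeviation (starOffset n) z + (z 3 - z 0) / 2))
        (leftDeviation (starOffset n) z) (edgeCorner i z 1) := by
  obtain ⟨h1, h2⟩ := starOffset_bounds hn
  obtain ⟨hl, hr, h3, h4⟩ := hz
  have e1 : z 1 = leftDeviation (starOffset n) z +
    ((z 0 + z 3) / 2 - starOffset n * ((z 3 - z 0) / 2)) := by unfold leftDeviation; ring
  have e2 : z 2 = rightDeviation (starOffset n) z +
    ((z 0 + z 3) / 2 + starOffset n * ((z 3 - z 0) / 2)) := by unfold rightDeviation; ring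
  set d := rightDeviation (starOffset n) z
  set e := leftDeviation (starOffset n) z
  have hd : 0 < e ^ 2 := by positivity
  fin_cases j <;> simp [edgeCorner, edgeFunctional_starPoint] at hj ⊢ <;>
    simp only [e1, e2] <;> nlinarith

lemma edgeCorner_notMem_convexHull_diff (hz : ConvexHeights (starOffset n) z) (k : Fin 4) :
    edgeCorner i z k ∉
      convexHull ℝ (convexHull ℝ (Set.range (edgeCorner i z)) \ {edgeCorner i z k}) := by
  fin_cases k
  · exact notMem_convexHull_diff (k := 0) _ fun j hj => edgeFunctional_lt_zero hn i hj
  · exact notMem_convexHull_diff (k := 1) _ fun j hj => edgeFunctional_lt_one hn i hz hj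
  · exact notMem_convexHull_diff (k := 2) _ fun j hj => edgeFunctional_lt_two hn i hz hj
  · exact notMem_convexHull_diff (k := 3) _ fun j hj => edgeFunctional_lt_three hn i hj

lemma exists_starPoint_of_mem_convexHull (hz : ConvexHeights (starOffset n) z)
    {p : EuclideanSpace ℝ (Fin 3)} (hp : p ∈ convexHull ℝ (Set.range (edgeCorner i z))) :
    ∃ x h : ℝ, p = starPoint i x h ∧ |x| ≤ 1 ∧ (x = 1 → h = z 3) ∧ (x = -1 → h = z 0) ∧
      (x = starOffset n → rightDeviation (starOffset n) z * (h - z 2) ≤ 0) ∧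
      (x = -starOffset n → leftDeviation (starOffset n) z * (h - z 1) ≤ 0) := by
  obtain ⟨h1, h2⟩ := starOffset_bounds hn
  have H : convexHull ℝ (Set.range (edgeCorner i z)) ⊆
      {p | ∃ x h : ℝ, p = starPoint i x h ∧ |x| ≤ 1} := by
    refine convexHull_min ?_ ?_
    · rintro _ ⟨j, rfl⟩
      fin_cases j
      · exact ⟨_, _, rfl, by norm_num⟩
      · exact ⟨_, _, rfl, by rw [abs_le]; constructor <;> linarith⟩
      · exact ⟨_, _, rfl, by rw [abs_le]; constructor <;> linarith⟩
      · exact ⟨_, _, rfl, by norm_num⟩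
    · rintro _ ⟨x, h, rfl, hx⟩ _ ⟨y, k, rfl, hy⟩ a b ha hb hab
      refine ⟨a * x + b * y, a * h + b * k, ?_, ?_⟩
      · ext m
        obtain rfl : a = 1 - b := by linarith
        fin_cases m <;> simp [starPoint] <;> ring
      · rw [abs_le] at *
        constructor <;> nlinarith
  obtain ⟨x, h, rfl, hx⟩ := H hp
  have i0 := eq_or_lt_of_mem_convexHull (q := edgeCorner i z) (k := 0) _
    (fun j hj => edgeFunctional_lt_zero hn i (j := j) hj) hp
  have i1 := eq_or_lt_of_mem_convexHull (q := edgeCorner i z) (k := 1) _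
    (fun j hj => edgeFunctional_lt_one hn i hz hj) hp
  have i2 := eq_or_lt_of_mem_convexHull (q := edgeCorner i z) (k := 2) _
    (fun j hj => edgeFunctional_lt_two hn i hz hj) hp
  have i3 := eq_or_lt_of_mem_convexHull (q := edgeCorner i z) (k := 3) _
    (fun j hj => edgeFunctional_lt_three hn i (j := j) hj) hp
  have hh : ∀ {y k : ℝ}, starPoint i x h = starPoint i y k → h = k := fun e => by
    simpa [starPoint] using congrArg (fun p : EuclideanSpace ℝ (Fin 3) => p 2) e
  simp only [edgeCorner, Matrix.cons_val, edgeFunctional_starPoint] at i0 i1 i2 i3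
  refine ⟨x, h, rfl, hx, ?_, ?_, ?_, ?_⟩
  · rintro rfl
    exact i3.elim hh fun e => by linarith
  · rintro rfl
    exact i0.elim hh fun e => by linarith
  · rintro rfl
    rcases i2 with e | e
    · rw [hh e]; simp
    · linarith
  · rintro rfl
    rcases i1 with e | e
    · rw [hh e]; simp
    · linarith

omit hn in
lemma dist_starPoint_sq (x y h k : ℝ) :
    dist (starPoint i x h) (starPoint i y k) ^ 2 = (x - y) ^ 2 + (h - k) ^ 2 := by
  rw [EuclideanSpace.dist_eq, Real.sq_sqrt (by positivity)]
  simp only [starPoint, Fin.sum_univ_three, Real.dist_eq, sq_abs, Matrix.cons_val]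
  linear_combination (x - y) ^ 2 * Real.sin_sq_add_cos_sq (stepAngle n * i.val)

lemma dist_edgeCorner (hz : ∀ j, |z j| ≤ 1) {j k : Fin 4} (hjk : j ≠ k) :
    2 / 5 ≤ dist (edgeCorner i z j) (edgeCorner i z k) ∧
      dist (edgeCorner i z j) (edgeCorner i z k) ≤ 4 := by
  obtain ⟨h1, h2⟩ := starOffset_bounds hn
  have hz' : ∀ j k, (z j - z k) ^ 2 ≤ 4 := fun j k => by
    have := abs_le.1 (hz j)
    have := abs_le.1 (hz k)
    nlinarith
  have key : ∀ x y h k : ℝ, 2 / 5 ≤ |x - y| → |x - y| ≤ 2 → (h - k) ^ 2 ≤ 4 →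
      2 / 5 ≤ dist (starPoint i x h) (starPoint i y k) ∧
        dist (starPoint i x h) (starPoint i y k) ≤ 4 := by
    intro x y h k a b c
    have e := dist_starPoint_sq i x y h k
    rw [← sq_abs (x - y)] at e
    constructor
    · refine le_of_sq_le_sq ?_ dist_nonneg
      nlinarith
    · refine le_of_sq_le_sq ?_ (by norm_num)
      nlinarith
  fin_cases j <;> fin_cases k <;> simp only [Fin.zero_eta, Fin.mk_one, Fin.reduceFinMk, ne_eq,
    not_true_eq_false] at hjk <;>
    refine key _ _ _ _ ?_ ?_ (hz' _ _) <;>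
    first
      | (rw [abs_of_nonneg (by linarith)]; linarith)
      | (rw [abs_of_nonpos (by linarith)]; linarith)

omit hn in
lemma coplanar_edgeCorner : Coplanar ℝ (Set.range (edgeCorner i z)) := by
  have key : ∀ x h y k : ℝ, starPoint i x h -ᵥ starPoint i y k =
      (x - y) • (starPoint i 1 0 - starPoint i 0 0) +
        (h - k) • (starPoint i 0 1 - starPoint i 0 0) := by
    intro x h y k
    ext m
    fin_cases m <;> simp [starPoint] <;> ring
  have mem : ∀ j, ∃ x h, edgeCorner i z j = starPoint i x h := by
    intro j
    fin_cases j <;> exact ⟨_, _, rfl⟩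
  have hle : vectorSpan ℝ (Set.range (edgeCorner i z)) ≤
      Submodule.span ℝ (({starPoint i 1 0 - starPoint i 0 0,
        starPoint i 0 1 - starPoint i 0 0} : Finset (EuclideanSpace ℝ (Fin 3))) : Set _) := by
    rw [vectorSpan_def, Submodule.span_le]
    rintro _ ⟨_, ⟨j, rfl⟩, _, ⟨k, rfl⟩, rfl⟩
    obtain ⟨x, h, hj⟩ := mem j
    obtain ⟨y, l, hk⟩ := mem k
    simp only [hj, hk, key, SetLike.mem_coe]
    exact add_mem (Submodule.smul_mem _ _ (Submodule.subset_span (by simp)))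
      (Submodule.smul_mem _ _ (Submodule.subset_span (by simp)))
  refine (Submodule.rank_mono hle).trans ((rank_span_finset_le _).trans ?_)
  exact_mod_cast Finset.card_le_two

omit hn in
lemma starPoint_mem_segment {s x y h k : ℝ} (h0 : 0 ≤ s) (h1 : s ≤ 1) :
    starPoint i ((1 - s) * x + s * y) ((1 - s) * h + s * k) ∈
      segment ℝ (starPoint i x h) (starPoint i y k) := by
  refine ⟨1 - s, s, by linarith, h0, by ring, ?_⟩
  ext m
  fin_cases m <;> simp [starPoint] <;> ring

lemma exists_perm_diagonals_inter (hz : ConvexHeights (starOffset n) z) :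
    ∃ σ : Equiv.Perm (Fin 4), (segment ℝ (edgeCorner i z (σ 0)) (edgeCorner i z (σ 2)) ∩
      segment ℝ (edgeCorner i z (σ 1)) (edgeCorner i z (σ 3))).Nonempty := by
  obtain ⟨h1, h2⟩ := starOffset_bounds hn
  obtain ⟨hl, hr, h3, h4⟩ := hz
  have e1 : z 1 = leftDeviation (starOffset n) z +
    ((z 0 + z 3) / 2 - starOffset n * ((z 3 - z 0) / 2)) := by unfold leftDeviation; ring
  have e2 : z 2 = rightDeviation (starOffset n) z +
    ((z 0 + z 3) / 2 + starOffset n * ((z 3 - z 0) / 2)) := by unfold rightDeviation; ring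
  set r := rightDeviation (starOffset n) z
  set l := leftDeviation (starOffset n) z
  set t := starOffset n
  rcases lt_or_gt_of_ne (mul_ne_zero hl hr) with hlr | hlr
  · have hm : l - r ≠ 0 := by
      intro h0
      have : l = r := by linarith
      rw [this] at hlr; nlinarith
    obtain ⟨s, hs⟩ : ∃ s, s * (l - r) = l := ⟨l / (l - r), by field_simp⟩
    have hm2 : 0 < (l - r) ^ 2 := by positivity
    have hs1 : 0 < s * (1 - s) := by
      have hrs : r = (s - 1) * (l - r) := by linear_combination -hs
      have : l * r = -(s * (1 - s)) * (l - r) ^ 2 := by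
        linear_combination -r * hs + s * (l - r) * hrs
      by_contra! h0
      nlinarith
    have hs0 : 0 ≤ s := by nlinarith
    have hs2 : s ≤ 1 := by nlinarith
    refine ⟨Equiv.swap 2 3, _, ?_, starPoint_mem_segment i hs0 hs2⟩
    have := starPoint_mem_segment i (s := (1 - t + 2 * t * s) / 2) (x := -1) (y := 1)
      (h := z 0) (k := z 3) (by nlinarith) (by nlinarith)
    change _ ∈ segment ℝ (starPoint i (-1) (z 0)) (starPoint i 1 (z 3))
    convert this using 2
    · change (1 - s) * -t + s * t = _
      ring
    · change (1 - s) * z 1 + s * z 2 = _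
      rw [e1, e2]
      linear_combination -hs
  · have hm : l + r ≠ 0 := by
      intro h0
      have : l = -r := by linarith
      rw [this] at hlr; nlinarith
    obtain ⟨s, hs⟩ : ∃ s, s * (l + r) = l := ⟨l / (l + r), by field_simp⟩
    have hm2 : 0 < (l + r) ^ 2 := by positivity
    have hrs : r = (1 - s) * (l + r) := by linear_combination hs
    have hlr' : l * r = s * (1 - s) * (l + r) ^ 2 := by
      linear_combination -r * hs + s * (l + r) * hrs
    have hs1 : 0 < s * (1 - s) := by
      rw [hlr'] at hlr
      exact pos_of_mul_pos_left hlr hm2.le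
    have hs0 : 0 < s := by nlinarith
    have hs2 : s < 1 := by nlinarith
    have hs3 : s * (1 - s) ≤ 4 / 3 * (1 - s) ^ 2 := by
      refine le_of_mul_le_mul_right ?_ hm2
      rw [← hlr', mul_assoc, ← mul_pow, ← hrs]
      exact h3
    have hs4 : s * (1 - s) ≤ 4 / 3 * s ^ 2 := by
      refine le_of_mul_le_mul_right ?_ hm2
      rw [← hlr', mul_assoc, ← mul_pow, hs]
      exact h4
    have hs5 : s ≤ 4 / 7 := by nlinarith
    have hs6 : 3 / 7 ≤ s := by nlinarith
    have ht : 0 < 1 + t := by linarith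
    refine ⟨1, _, starPoint_mem_segment i (s := 2 * s / (1 + t)) (by positivity)
      ((div_le_one ht).2 (by linarith)), ?_⟩
    have := starPoint_mem_segment i (s := (2 * s - 1 + t) / (1 + t)) (x := -t) (y := 1)
      (h := z 1) (k := z 3) (div_nonneg (by linarith) ht.le) ((div_le_one ht).2 (by linarith))
    change _ ∈ segment ℝ (starPoint i (-t) (z 1)) (starPoint i 1 (z 3))
    convert this using 2
    · change (1 - 2 * s / (1 + t)) * -1 + 2 * s / (1 + t) * t = _
      field_simp
      ring
    · change (1 - 2 * s / (1 + t)) * z 0 + 2 * s / (1 + t) * z 2 = _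
      rw [e1, e2]
      field_simp
      linear_combination 4 * hs

end Quadrilateral

/-- Heights of the vertices (`b`) and of the crossings (`a`) of the star polygon for which
the vertical quadrilaterals over its edges are in contact without crossing each other. -/
structure AdmissibleHeights (n : ℕ) (t : ℝ) (a b : ZMod n → ℝ) : Prop where
  abs_a_le : ∀ i, |a i| ≤ 1
  abs_b_le : ∀ i, |b i| ≤ 1
  convex : ∀ i, ConvexHeights t ![b (i - 2), a (i - 1), a i, b i]
  opposite : ∀ i, rightDeviation t ![b (i - 2), a (i - 1), a i, b i] *
    leftDeviation t ![b (i + 1 - 2), a (i + 1 - 1), a (i + 1), b (i + 1)] < 0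

lemma exists_admissibleHeights_of_even {n : ℕ} (hn : 2 ∣ n) (t : ℝ) :
    ∃ a b : ZMod n → ℝ, AdmissibleHeights n t a b := by
  let g : ZMod 2 → ℝ := fun x => if x = 0 then 1 else -1
  let φ := ZMod.castHom hn (ZMod 2)
  have hg : ∀ x, g (x + 1) = -g x := by
    intro x
    have hx : x = 0 ∧ x + 1 ≠ 0 ∨ x ≠ 0 ∧ x + 1 = 0 := by revert x; decide
    rcases hx with ⟨h, h'⟩ | ⟨h, h'⟩
    · simp only [g, if_pos h, if_neg h']
    · simp only [g, if_neg h, if_pos h', neg_neg]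
  have hg2 : ∀ x, g x = 1 ∨ g x = -1 := fun x => by
    by_cases h : x = 0 <;> simp [g, h]
  have hb2 : ∀ i, g (φ (i - 2)) = g (φ i) := fun i => by
    have : (2 : ZMod 2) = 0 := rfl
    rw [map_sub, map_ofNat, this, sub_zero]
  have hr : ∀ i, rightDeviation t ![g (φ (i - 2)), 0, 0, g (φ i)] = -g (φ i) := fun i => by
    simp only [rightDeviation, Matrix.cons_val, hb2]; ring
  have hl : ∀ i, leftDeviation t ![g (φ (i - 2)), 0, 0, g (φ i)] = -g (φ i) := fun i => by
    simp only [leftDeviation, Matrix.cons_val, hb2]; ring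
  refine ⟨fun _ => 0, fun i => g (φ i), by simp, fun i => ?_, fun i => ⟨?_, ?_, ?_, ?_⟩,
    fun i => ?_⟩
  · rcases hg2 (φ i) with h | h <;> simp [h]
  all_goals
    simp only [hr, hl]
    try simp only [map_add, map_one, hg]
    rcases hg2 (φ i) with h | h <;> rw [h] <;> norm_num

lemma val_sub_eq_ite {n : ℕ} (i : ZMod n) {k : ℕ} (hk : k < n) :
    (i - k).val = if i.val < k then i.val + n - k else i.val - k := by
  have : NeZero n := ⟨by omega⟩
  have hi := i.val_lt
  have h : i - k = ((if i.val < k then i.val + n - k else i.val - k : ℕ) : ZMod n) := by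
    split_ifs with h
    · rw [Nat.cast_sub (by omega)]; simp
    · rw [Nat.cast_sub (by omega)]; simp
  rw [h, ZMod.val_natCast_of_lt]
  split_ifs <;> omega

lemma exists_admissibleHeights_of_odd {n : ℕ} (hn : 5 ≤ n) (hodd : Odd n) {t : ℝ}
    (h1 : 1 / 5 ≤ t) (h2 : t ≤ 1 / 2) : ∃ a b : ZMod n → ℝ, AdmissibleHeights n t a b := by
  have : NeZero n := ⟨by omega⟩
  let A : ℕ → ℝ := fun v => if v = 0 then -1 / 10 + 9 * t / 10 else
    if v = 1 then 1 / 10 - 9 * t / 10 else 0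
  let B : ℕ → ℝ := fun v => if v = 0 then 0 else (-1) ^ v
  have hs1 : ∀ i : ZMod n, (i - 1).val = if i.val < 1 then i.val + n - 1 else i.val - 1 :=
    fun i => by simpa using val_sub_eq_ite i (k := 1) (by omega)
  have hs2 : ∀ i : ZMod n, (i - 2).val = if i.val < 2 then i.val + n - 2 else i.val - 2 :=
    fun i => by simpa using val_sub_eq_ite i (k := 2) (by omega)
  let z : ZMod n → Fin 4 → ℝ := fun i => ![B (i - 2).val, A (i - 1).val, A i.val, B i.val]
  have hB : ∀ {v}, v ≠ 0 → B v = (-1) ^ v := fun h => if_neg h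
  have hA : ∀ {v}, 2 ≤ v → A v = 0 := fun h => by
    simp only [A]; rw [if_neg (by omega), if_neg (by omega)]
  have hev : ∀ {v}, v + 1 = n → (-1 : ℝ) ^ v = 1 := fun h => by
    refine Even.neg_one_pow ?_
    rw [← h] at hodd
    exact (Nat.not_odd_iff_even.1 fun h => by
      rw [Nat.odd_add_one] at hodd; exact hodd h)
  have hd : ∀ {v}, v + 2 = n → (-1 : ℝ) ^ v = -1 := fun {v} h => by
    have := hev (v := v + 1) (by omega)
    rw [pow_succ] at this; linarith
  have z0 : ∀ i : ZMod n, i.val = 0 → leftDeviation t (z i) = (1 + t) / 2 ∧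
      rightDeviation t (z i) = 2 * (1 + t) / 5 := by
    intro i hi
    have e1 : A (i - 1).val = 0 := by rw [hs1, hi, if_pos (by omega), hA (by omega)]
    have e2 : B (i - 2).val = -1 := by
      rw [hs2, hi, if_pos (by omega), hB (by omega), hd (by omega)]
    have e3 : A i.val = -1 / 10 + 9 * t / 10 := by rw [hi]; rfl
    have e4 : B i.val = 0 := by rw [hi]; rfl
    simp only [leftDeviation, rightDeviation, z, Matrix.cons_val, e1, e2, e3, e4]
    constructor <;> ring
  have z1 : ∀ i : ZMod n, i.val = 1 → leftDeviation t (z i) = -(1 + t) / 10 ∧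
      rightDeviation t (z i) = (1 + t) / 10 := by
    intro i hi
    have e1 : A (i - 1).val = -1 / 10 + 9 * t / 10 := by
      rw [hs1, hi, if_neg (by omega)]; rfl
    have e2 : B (i - 2).val = 1 := by
      rw [hs2, hi, if_pos (by omega), hB (by omega), hev (by omega)]
    have e3 : A i.val = 1 / 10 - 9 * t / 10 := by rw [hi]; rfl
    have e4 : B i.val = -1 := by rw [hi, hB one_ne_zero, pow_one]
    simp only [leftDeviation, rightDeviation, z, Matrix.cons_val, e1, e2, e3, e4]
    constructor <;> ring
  have z2 : ∀ i : ZMod n, i.val = 2 → leftDeviation t (z i) = -(2 * (1 + t) / 5) ∧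
      rightDeviation t (z i) = -((1 + t) / 2) := by
    intro i hi
    have e1 : A (i - 1).val = 1 / 10 - 9 * t / 10 := by
      rw [hs1, hi, if_neg (by omega)]; rfl
    have e2 : B (i - 2).val = 0 := by rw [hs2, hi, if_neg (by omega)]; rfl
    have e3 : A i.val = 0 := hA hi.ge
    have e4 : B i.val = 1 := by rw [hi, hB two_ne_zero]; norm_num
    simp only [leftDeviation, rightDeviation, z, Matrix.cons_val, e1, e2, e3, e4]
    constructor <;> ring
  have z3 : ∀ i : ZMod n, 3 ≤ i.val → leftDeviation t (z i) = -(-1) ^ i.val ∧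
      rightDeviation t (z i) = -(-1) ^ i.val := by
    intro i hi
    have e1 : A (i - 1).val = 0 := by rw [hs1, if_neg (by omega), hA (by omega)]
    have e2 : B (i - 2).val = (-1) ^ i.val := by
      rw [hs2, if_neg (by omega), hB (by omega)]
      obtain ⟨m, hm⟩ : ∃ m, i.val = m + 2 := ⟨i.val - 2, by omega⟩
      rw [hm, Nat.add_sub_cancel, pow_add]; norm_num
    have e3 : A i.val = 0 := hA (by omega)
    have e4 : B i.val = (-1) ^ i.val := hB (by omega)
    simp only [leftDeviation, rightDeviation, z, Matrix.cons_val, e1, e2, e3, e4]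
    constructor <;> ring
  have hcases : ∀ i : ZMod n, i.val = 0 ∨ i.val = 1 ∨ i.val = 2 ∨ 3 ≤ i.val := fun i => by omega
  refine ⟨fun i => A i.val, fun i => B i.val, fun i => ?_, fun i => ?_, fun i => ?_, fun i => ?_⟩
  · simp only [A]
    rw [abs_le]
    split_ifs <;> constructor <;> linarith
  · simp only [B]
    split_ifs
    · simp
    · simp
  · change ConvexHeights t (z i)
    rcases hcases i with h | h | h | h
    · obtain ⟨hl, hr⟩ := z0 i h
      constructor <;> simp only [hl, hr]
      · exact ne_of_gt (by linarith)
      · exact ne_of_gt (by linarith)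
      all_goals nlinarith
    · obtain ⟨hl, hr⟩ := z1 i h
      constructor <;> simp only [hl, hr]
      · exact ne_of_lt (by linarith)
      · exact ne_of_gt (by linarith)
      all_goals nlinarith
    · obtain ⟨hl, hr⟩ := z2 i h
      constructor <;> simp only [hl, hr]
      · exact ne_of_lt (by linarith)
      · exact ne_of_lt (by linarith)
      all_goals nlinarith
    · obtain ⟨hl, hr⟩ := z3 i h
      constructor <;> simp only [hl, hr]
      all_goals rcases neg_one_pow_eq_or ℝ i.val with h' | h' <;> rw [h'] <;> norm_num
  · change rightDeviation t (z i) * leftDeviation t (z (i + 1)) < 0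
    have hv := val_sub_eq_ite (i + 1) (k := 1) (by omega)
    have hlt := (i + 1).val_lt
    rw [Nat.cast_one, add_sub_cancel_right] at hv
    have hw : i.val + 1 = n ∧ (i + 1).val = 0 ∨ (i + 1).val = i.val + 1 := by
      split_ifs at hv <;> omega
    rcases hw with ⟨h, hw⟩ | hw
    · rw [(z3 i (by omega)).2, (z0 _ hw).1, hev h]
      linarith
    rcases hcases i with h | h | h | h
    · rw [(z0 i h).2, (z1 _ (by omega)).1]
      nlinarith
    · rw [(z1 i h).2, (z2 _ (by omega)).1]
      nlinarith
    · rw [(z2 i h).2, (z3 _ (by omega)).1, hw, h]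
      norm_num
      linarith
    · rw [(z3 i h).2, (z3 _ (by omega)).1, hw, pow_succ]
      rcases neg_one_pow_eq_or ℝ i.val with h' | h' <;> rw [h'] <;> norm_num

lemma exists_admissibleHeights {n : ℕ} (hn : 5 ≤ n) :
    ∃ a b : ZMod n → ℝ, AdmissibleHeights n (starOffset n) a b := by
  rcases Nat.even_or_odd n with h | h
  · exact exists_admissibleHeights_of_even h.two_dvd _
  · exact exists_admissibleHeights_of_odd hn h (starOffset_bounds hn).1 (starOffset_bounds hn).2

lemma eq_zero_of_mul_nonpos {r l d : ℝ} (h : r * l < 0) (hr : r * d ≤ 0) (hl : l * d ≤ 0) :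
    d = 0 := by
  by_contra hd
  have h1 : 0 < d ^ 2 := by positivity
  have h2 := mul_nonneg_of_nonpos_of_nonpos hr hl
  nlinarith

/-- Heights of the corners of the quadrilateral over the `i`-th edge. -/
def cornerHeights {n : ℕ} (a b : ZMod n → ℝ) (i : ZMod n) : Fin 4 → ℝ :=
  ![b (i - 2), a (i - 1), a i, b i]

lemma inter_convexHull_edgeCorner {n : ℕ} (hn : 5 ≤ n) {a b : ZMod n → ℝ}
    (H : AdmissibleHeights n (starOffset n) a b) {u v : ZMod n} (huv : u ≠ v)
    {p : EuclideanSpace ℝ (Fin 3)}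
    (hu : p ∈ convexHull ℝ (Set.range (edgeCorner u (cornerHeights a b u))))
    (hv : p ∈ convexHull ℝ (Set.range (edgeCorner v (cornerHeights a b v)))) :
    (v = u + 1 ∧ p = starPoint u (starOffset n) (a u)) ∨ (v = u + 2 ∧ p = starPoint u 1 (b u)) ∨
      (u = v + 1 ∧ p = starPoint v (starOffset n) (a v)) ∨
      (u = v + 2 ∧ p = starPoint v 1 (b v)) := by
  obtain ⟨x, h, rfl, hx, u3, -, u2, u1⟩ := exists_starPoint_of_mem_convexHull hn u (H.convex u) hu
  obtain ⟨y, k, e, hy, v3, -, v2, v1⟩ := exists_starPoint_of_mem_convexHull hn v (H.convex v) hv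
  obtain ⟨rfl, rfl, hc⟩ := starPoint_eq_starPoint hn huv hx e
  rcases hc with ⟨rfl, rfl⟩ | ⟨rfl, rfl⟩ | ⟨rfl, rfl⟩ | ⟨rfl, rfl⟩
  · left
    have h1 := u2 rfl
    have h2 := v1 rfl
    simp only [Matrix.cons_val] at h1 h2
    rw [add_sub_cancel_right] at h2
    have := eq_zero_of_mul_nonpos (by simpa using H.opposite u) h1 (by simpa using h2)
    rw [sub_eq_zero.1 this]
    exact ⟨rfl, rfl⟩
  · right; left
    refine ⟨rfl, ?_⟩
    rw [u3 rfl]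
    rfl
  · right; right; left
    have h1 := v2 (neg_neg _)
    have h2 := u1 rfl
    simp only [Matrix.cons_val] at h1 h2
    rw [add_sub_cancel_right] at h2
    have := eq_zero_of_mul_nonpos (by simpa using H.opposite v) h1 (by simpa using h2)
    rw [sub_eq_zero.1 this]
    exact ⟨rfl, starPoint_add_one hn v _⟩
  · right; right; right
    refine ⟨rfl, ?_⟩
    rw [v3 (neg_neg _), starPoint_add_two hn]
    rfl

/-- The contact point of the quadrilaterals over the edges `u` and `v`. -/
noncomputable def contactPoint {n : ℕ} (a b : ZMod n → ℝ) (u v : ZMod n) :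
    EuclideanSpace ℝ (Fin 3) :=
  if v = u + 1 then starPoint u (starOffset n) (a u)
  else if u = v + 1 then starPoint v (starOffset n) (a v)
  else if v = u + 2 then starPoint u 1 (b u)
  else starPoint v 1 (b v)

section Contact

variable {n : ℕ} (hn : 5 ≤ n)

include hn

lemma natCast_ne_zero_of_lt_five {k : ℕ} (h0 : k ≠ 0) (hk : k < 5) : (k : ZMod n) ≠ 0 := by
  rw [Ne, ZMod.natCast_eq_zero_iff]
  intro h
  have := Nat.le_of_dvd (by omega) h
  omega

lemma small_ne_zero : (1 : ZMod n) ≠ 0 ∧ (2 : ZMod n) ≠ 0 ∧ (3 : ZMod n) ≠ 0 ∧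
    (4 : ZMod n) ≠ 0 := by
  refine ⟨?_, ?_, ?_, ?_⟩
  · simpa using natCast_ne_zero_of_lt_five hn (k := 1) (by norm_num) (by norm_num)
  · simpa using natCast_ne_zero_of_lt_five hn (k := 2) (by norm_num) (by norm_num)
  · simpa using natCast_ne_zero_of_lt_five hn (k := 3) (by norm_num) (by norm_num)
  · simpa using natCast_ne_zero_of_lt_five hn (k := 4) (by norm_num) (by norm_num)

omit hn in
lemma contactPoint_add_one (a b : ZMod n → ℝ) (u : ZMod n) :
    contactPoint a b u (u + 1) = starPoint u (starOffset n) (a u) := if_pos rfl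

lemma contactPoint_add_one' (a b : ZMod n → ℝ) (u : ZMod n) :
    contactPoint a b (u + 1) u = starPoint u (starOffset n) (a u) := by
  obtain ⟨h1, h2, h3, h4⟩ := small_ne_zero hn
  rw [contactPoint, if_neg, if_pos rfl]
  exact fun h => h2 (by linear_combination -h)

lemma contactPoint_add_two (a b : ZMod n → ℝ) (u : ZMod n) :
    contactPoint a b u (u + 2) = starPoint u 1 (b u) := by
  obtain ⟨h1, h2, h3, h4⟩ := small_ne_zero hn
  rw [contactPoint, if_neg, if_neg, if_pos rfl]
  · exact fun h => h3 (by linear_combination -h)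
  · exact fun h => h1 (by linear_combination h)

lemma contactPoint_add_two' (a b : ZMod n → ℝ) (u : ZMod n) :
    contactPoint a b (u + 2) u = starPoint u 1 (b u) := by
  obtain ⟨h1, h2, h3, h4⟩ := small_ne_zero hn
  rw [contactPoint, if_neg, if_neg, if_neg]
  · exact fun h => h4 (by linear_combination -h)
  · exact fun h => h1 (by linear_combination h)
  · exact fun h => h3 (by linear_combination -h)

lemma cycleSquareAdj_iff {u v : ZMod n} : cycleSquareAdj n u v ↔
    v = u + 1 ∨ v = u + 2 ∨ u = v + 1 ∨ u = v + 2 := by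
  obtain ⟨h1, h2, -, -⟩ := small_ne_zero hn
  constructor
  · rintro ⟨-, h | h | h | h⟩
    · exact Or.inr (Or.inr (Or.inl (by linear_combination h)))
    · exact Or.inl (by linear_combination -h)
    · exact Or.inr (Or.inr (Or.inr (by linear_combination h)))
    · exact Or.inr (Or.inl (by linear_combination -h))
  · rintro (rfl | rfl | rfl | rfl)
    · exact ⟨by simpa using h1, by simp⟩
    · exact ⟨by simpa using h2, by simp⟩
    · exact ⟨by simpa using h1, by simp⟩
    · exact ⟨by simpa using h2, by simp⟩

lemma contactPoint_comm (a b : ZMod n → ℝ) {u v : ZMod n} (h : cycleSquareAdj n u v) :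
    contactPoint a b u v = contactPoint a b v u := by
  rcases (cycleSquareAdj_iff hn).1 h with rfl | rfl | rfl | rfl <;>
    simp only [contactPoint_add_one, contactPoint_add_one' hn, contactPoint_add_two hn,
      contactPoint_add_two' hn]

lemma eq_of_starPoint_eq {x y z w : ℝ} (hx : 0 < x) (hx1 : x ≤ 1) (hy : 0 < y) {u v : ZMod n}
    (h : starPoint u x z = starPoint v y w) : u = v ∧ x = y := by
  by_cases huv : u = v
  · subst huv
    have := congrArg (edgeFunctional u 1 0) h
    simp only [edgeFunctional_starPoint] at this
    exact ⟨rfl, by linarith⟩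
  · obtain ⟨hxy, -⟩ := starPoint_eq_starPoint hn huv (abs_le.2 ⟨by linarith, hx1⟩) h
    linarith

lemma exists_contactPoint_eq (a b : ZMod n → ℝ) {u v : ZMod n} (h : cycleSquareAdj n u v) :
    ∃ w : ZMod n,
      (({u, v} : Set (ZMod n)) = {w, w + 1} ∧
        contactPoint a b u v = starPoint w (starOffset n) (a w)) ∨
      (({u, v} : Set (ZMod n)) = {w, w + 2} ∧ contactPoint a b u v = starPoint w 1 (b w)) := by
  rcases (cycleSquareAdj_iff hn).1 h with rfl | rfl | rfl | rfl
  · exact ⟨u, Or.inl ⟨rfl, contactPoint_add_one a b u⟩⟩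
  · exact ⟨u, Or.inr ⟨rfl, contactPoint_add_two hn a b u⟩⟩
  · exact ⟨v, Or.inl ⟨Set.pair_comm _ _, contactPoint_add_one' hn a b v⟩⟩
  · exact ⟨v, Or.inr ⟨Set.pair_comm _ _, contactPoint_add_two' hn a b v⟩⟩

lemma pair_eq_of_contactPoint_eq (a b : ZMod n → ℝ) {u v u' v' : ZMod n}
    (h : cycleSquareAdj n u v) (h' : cycleSquareAdj n u' v')
    (e : contactPoint a b u v = contactPoint a b u' v') :
    ({u, v} : Set (ZMod n)) = {u', v'} := by
  obtain ⟨h1, h2⟩ := starOffset_bounds hn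
  obtain ⟨w, ⟨hs, hc⟩ | ⟨hs, hc⟩⟩ := exists_contactPoint_eq hn a b h <;>
    obtain ⟨w', ⟨hs', hc'⟩ | ⟨hs', hc'⟩⟩ := exists_contactPoint_eq hn a b h' <;>
    rw [hc, hc'] at e <;>
    obtain ⟨rfl, hx⟩ := eq_of_starPoint_eq hn (by linarith) (by linarith) (by linarith) e
  · rw [hs, hs']
  · linarith
  · linarith
  · rw [hs, hs']

lemma edgeCorner_cornerHeights (a b : ZMod n → ℝ) (v : ZMod n) :
    edgeCorner v (cornerHeights a b v) = ![contactPoint a b v (v - 2), contactPoint a b v (v - 1),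
      contactPoint a b v (v + 1), contactPoint a b v (v + 2)] := by
  have e1 : contactPoint a b v (v - 1) = starPoint v (-starOffset n) (a (v - 1)) := by
    have h := contactPoint_add_one' hn a b (v - 1)
    rwa [← starPoint_add_one hn, sub_add_cancel] at h
  have e2 : contactPoint a b v (v - 2) = starPoint v (-1) (b (v - 2)) := by
    have h := contactPoint_add_two' hn a b (v - 2)
    rwa [← starPoint_add_two hn, sub_add_cancel] at h
  rw [e1, e2, contactPoint_add_one, contactPoint_add_two hn]
  rfl

lemma range_edgeCorner (a b : ZMod n → ℝ) (v : ZMod n) :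
    Set.range (edgeCorner v (cornerHeights a b v)) =
      {x | ∃ u, cycleSquareAdj n v u ∧ x = contactPoint a b v u} := by
  rw [edgeCorner_cornerHeights hn]
  ext x
  simp only [cycleSquareAdj_iff hn, Set.mem_range, Set.mem_ofPred_eq]
  constructor
  · rintro ⟨j, rfl⟩
    fin_cases j
    · exact ⟨v - 2, by simp, rfl⟩
    · exact ⟨v - 1, by simp, rfl⟩
    · exact ⟨v + 1, by simp, rfl⟩
    · exact ⟨v + 2, by simp, rfl⟩
  · rintro ⟨u, rfl | rfl | rfl | rfl, rfl⟩
    · exact ⟨2, rfl⟩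
    · exact ⟨3, rfl⟩
    · exact ⟨1, by simp⟩
    · exact ⟨0, by simp⟩

end Contact

/-- **Theorem 5 of the paper.** There is a constant `C ≥ 1` such that for
every `n ≥ 5` the graph `Cₙ²` admits a contact representation by convex quadrilaterals in
ℝ³ in which the ratio between the longest and the shortest quadrilateral side over the
whole representation is at most `C`.  Here `c u v` is the contact point of the edge `uv`
and `q v 0, q v 1, q v 2, q v 3` are the corners of the quadrilateral `Q v` of vertex `v`
in cyclic order (the diagonals `[q v 0, q v 2]` and `[q v 1, q v 3]` intersect). -/
theorem cycle_square_bounded_ratio_quadrilaterals :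
    ∃ C : ℝ, 1 ≤ C ∧ ∀ n : ℕ, 5 ≤ n →
      ∃ (c : ZMod n → ZMod n → EuclideanSpace ℝ (Fin 3))
        (q : ZMod n → Fin 4 → EuclideanSpace ℝ (Fin 3)),
        -- the contact-point assignment is well defined and injective on edges
        (∀ u v, cycleSquareAdj n u v → c u v = c v u) ∧
        (∀ u v u' v', cycleSquareAdj n u v → cycleSquareAdj n u' v' →
          c u v = c u' v' → ({u, v} : Set (ZMod n)) = {u', v'}) ∧
        (∀ v : ZMod n,
          -- the corners of Q v are exactly the contact points of edges incident to v
          Function.Injective (q v) ∧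
          Set.range (q v) = {x | ∃ u, cycleSquareAdj n v u ∧ x = c v u} ∧
          -- the four corners are coplanar
          Coplanar ℝ (Set.range (q v)) ∧
          -- each corner is an extreme point of Q v
          (∀ i, q v i ∉ convexHull ℝ
            ((convexHull ℝ (Set.range (q v))) \ {q v i})) ∧
          -- the labeling is in cyclic order: the diagonals intersect
          (segment ℝ (q v 0) (q v 2) ∩ segment ℝ (q v 1) (q v 3)).Nonempty) ∧
        -- quadrilaterals of adjacent vertices meet exactly in the contact point
        (∀ u v, cycleSquareAdj n u v →
          convexHull ℝ (Set.range (q u)) ∩ convexHull ℝ (Set.range (q v)) = {c u v}) ∧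
        -- quadrilaterals of distinct non-adjacent vertices are disjoint
        (∀ u v, u ≠ v → ¬ cycleSquareAdj n u v →
          convexHull ℝ (Set.range (q u)) ∩ convexHull ℝ (Set.range (q v)) = ∅) ∧
        -- the ratio of any two side lengths is at most C
        (∀ (v v' : ZMod n) (i j : Fin 4),
          dist (q v i) (q v (i + 1)) ≤ C * dist (q v' j) (q v' (j + 1))) := by
  refine ⟨10, by norm_num, fun n hn => ?_⟩
  obtain ⟨a, b, H⟩ := exists_admissibleHeights hn
  have habs : ∀ v j, |cornerHeights a b v j| ≤ 1 := by
    intro v j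
    fin_cases j
    · exact H.abs_b_le _
    · exact H.abs_a_le _
    · exact H.abs_a_le _
    · exact H.abs_b_le _
  choose σ hσ using fun v => exists_perm_diagonals_inter hn v (H.convex v)
  have hrange : ∀ v, Set.range (edgeCorner v (cornerHeights a b v) ∘ σ v) =
      Set.range (edgeCorner v (cornerHeights a b v)) := fun v => (σ v).surjective.range_comp _
  have hdist : ∀ v {j k : Fin 4}, j ≠ k →
      2 / 5 ≤ dist (edgeCorner v (cornerHeights a b v) (σ v j))
          (edgeCorner v (cornerHeights a b v) (σ v k)) ∧
        dist (edgeCorner v (cornerHeights a b v) (σ v j))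
          (edgeCorner v (cornerHeights a b v) (σ v k)) ≤ 4 :=
    fun v j k hjk => dist_edgeCorner hn v (habs v) ((σ v).injective.ne hjk)
  have hmem : ∀ {u v}, cycleSquareAdj n u v →
      contactPoint a b u v ∈ convexHull ℝ (Set.range (edgeCorner u (cornerHeights a b u))) := by
    intro u v h
    apply subset_convexHull
    rw [range_edgeCorner hn]
    exact ⟨v, h, rfl⟩
  refine ⟨contactPoint a b, fun v => edgeCorner v (cornerHeights a b v) ∘ σ v,
    fun u v h => contactPoint_comm hn a b h,
    fun u v u' v' h h' e => pair_eq_of_contactPoint_eq hn a b h h' e,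
    fun v => ⟨?_, ?_, ?_, ?_, hσ v⟩, ?_, ?_, ?_⟩
  · intro j k h
    by_contra hjk
    have h1 := (hdist v hjk).1
    simp only [Function.comp_apply] at h
    rw [h, dist_self] at h1
    norm_num at h1
  · rw [hrange, range_edgeCorner hn]
  · rw [hrange]
    exact coplanar_edgeCorner v
  · intro j
    rw [hrange]
    exact edgeCorner_notMem_convexHull_diff hn v (H.convex v) (σ v j)
  · intro u v h
    simp only [hrange]
    refine Set.Subset.antisymm ?_ ?_
    · rintro p ⟨hu, hv⟩
      rw [Set.mem_singleton_iff]
      rcases inter_convexHull_edgeCorner hn H h.1 hu hv with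
        ⟨rfl, rfl⟩ | ⟨rfl, rfl⟩ | ⟨rfl, rfl⟩ | ⟨rfl, rfl⟩
      · rw [contactPoint_add_one]
      · rw [contactPoint_add_two hn]
      · rw [contactPoint_add_one' hn]
      · rw [contactPoint_add_two' hn]
    · rintro _ rfl
      refine ⟨hmem h, ?_⟩
      rw [contactPoint_comm hn a b h]
      refine hmem ((cycleSquareAdj_iff hn).2 ?_)
      have := (cycleSquareAdj_iff hn).1 h
      tauto
  · intro u v huv h
    simp only [hrange]
    rw [Set.eq_empty_iff_forall_notMem]
    rintro p ⟨hu, hv⟩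
    refine h ((cycleSquareAdj_iff hn).2 ?_)
    rcases inter_convexHull_edgeCorner hn H huv hu hv with h | h | h | h
    · exact Or.inl h.1
    · exact Or.inr (Or.inl h.1)
    · exact Or.inr (Or.inr (Or.inl h.1))
    · exact Or.inr (Or.inr (Or.inr h.1))
  · intro v v' j k
    have h1 := (hdist v (j := j) (k := j + 1) (by fin_cases j <;> decide)).2
    have h2 := (hdist v' (j := k) (k := k + 1) (by fin_cases k <;> decide)).1
    simp only [Function.comp_apply]
    linarith
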